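/- Let a, b > 0, let M be a point of the ellipse E(a,b), and let θ = π/3. Suppose c ∈ ℝ² and a symmetric positive-definite matrix Q are such that every chord NL of E(a,b) subtending angle π/3 at M is tangent to E(c,Q). Let ℓ₁ and ℓ₂ be two distinct lines through M each tangent to E(c,Q), and let T₁ ∈ ℓ₁ ∩ E(a,b) and T₂ ∈ ℓ₂ ∩ E(a,b) with T₁ ≠ M and T₂ ≠ M. Then the line through T₁ and T₂ is also tangent to E(c,Q); that is, the triangle M T₁ T₂ circumscribes the Frégier ellipse E(c,Q). -/

import Mathlib

open EuclideanGeometry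

noncomputable section

/-- Points of the Euclidean plane. -/
abbrev Pt := EuclideanSpace ℝ (Fin 2)

/-- The ellipse with semi-axes `a`, `b`, centered at the origin. -/
def ellipseE (a b : ℝ) : Set Pt := {p | p 0 ^ 2 / a ^ 2 + p 1 ^ 2 / b ^ 2 = 1}

/-- The ellipse `{p : (p−c)ᵀ Q (p−c) = 1}` with center `c` and positive-definite
symmetric matrix `Q`. -/
def ellipseQ (c : Pt) (Q : Matrix (Fin 2) (Fin 2) ℝ) : Set Pt :=
  {p | ∑ i, ∑ j, (p i - c i) * Q i j * (p j - c j) = 1}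

/-- The line (affine span) through two points. -/
def lineThrough (P Q : Pt) : Set Pt := (affineSpan ℝ {P, Q} : Set Pt)

/-- A line is tangent to a set if they meet in exactly one point. -/
def IsTangentTo (l S : Set Pt) : Prop := ∃! p, p ∈ l ∩ S

/-- `l` is a line of the plane (the affine span of two distinct points). -/
def IsLine (l : Set Pt) : Prop := ∃ P Q : Pt, P ≠ Q ∧ l = lineThrough P Q

/-- Vanishes exactly when the line `PR` is tangent to `ellipseQ c Q`. -/
def tangencyForm (c : Pt) (Q : Matrix (Fin 2) (Fin 2) ℝ) (P R : Pt) : ℝ :=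
  Q 0 0 * (R 0 - P 0) ^ 2 + 2 * Q 0 1 * (R 0 - P 0) * (R 1 - P 1) + Q 1 1 * (R 1 - P 1) ^ 2 -
    (Q 0 0 * Q 1 1 - Q 0 1 ^ 2) * ((P 0 - c 0) * (R 1 - P 1) - (P 1 - c 1) * (R 0 - P 0)) ^ 2

/-- Twice the signed area of the triangle `MPR`. -/
def signedArea (M P R : Pt) : ℝ :=
  (P 0 - M 0) * (R 1 - M 1) - (P 1 - M 1) * (R 0 - M 0)

lemma tangencyForm_comm (c : Pt) (Q : Matrix (Fin 2) (Fin 2) ℝ) (P R : Pt) :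
    tangencyForm c Q P R = tangencyForm c Q R P := by
  unfold tangencyForm; ring

lemma continuous_tangencyForm (c : Pt) (Q : Matrix (Fin 2) (Fin 2) ℝ) {f g : ℝ → Pt}
    (hf : ∀ i, Continuous fun t ↦ f t i) (hg : ∀ i, Continuous fun t ↦ g t i) :
    Continuous fun t ↦ tangencyForm c Q (f t) (g t) := by
  have key : ∀ p₀ p₁ r₀ r₁ : ℝ → ℝ, Continuous p₀ → Continuous p₁ → Continuous r₀ →
      Continuous r₁ → Continuous fun t ↦
        Q 0 0 * (r₀ t - p₀ t) ^ 2 + 2 * Q 0 1 * (r₀ t - p₀ t) * (r₁ t - p₁ t) +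
          Q 1 1 * (r₁ t - p₁ t) ^ 2 - (Q 0 0 * Q 1 1 - Q 0 1 ^ 2) *
            ((p₀ t - c 0) * (r₁ t - p₁ t) - (p₁ t - c 1) * (r₀ t - p₀ t)) ^ 2 := by
    intro p₀ p₁ r₀ r₁ h₁ h₂ h₃ h₄
    generalize c 0 = c₀, c 1 = c₁
    fun_prop
  exact key _ _ _ _ (hf 0) (hf 1) (hg 0) (hg 1)

lemma existsUnique_quadratic_root_iff {A B C : ℝ} (hA : 0 < A) :
    (∃! t : ℝ, A * t ^ 2 + 2 * B * t + C = 0) ↔ B ^ 2 - A * C = 0 := by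
  constructor
  · rintro ⟨t, ht, huniq⟩
    have hs : -2 * B / A - t = t := by
      apply huniq
      field_simp
      linear_combination A * ht
    have hB : B = -A * t := by
      field_simp at hs
      linarith
    subst hB
    linear_combination -A * ht
  · intro h
    have key : ∀ t, A * (A * t ^ 2 + 2 * B * t + C) = (A * t + B) ^ 2 := fun t ↦ by
      linear_combination -h
    refine ⟨-B / A, ?_, fun t ht ↦ ?_⟩
    · refine (mul_eq_zero.1 ?_).resolve_left hA.ne'
      rw [key]
      field_simp
      ring
    · have := key t
      rw [ht, mul_zero, eq_comm, sq_eq_zero_iff] at this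
      field_simp
      linarith

lemma posDef_fin_two_coeff {Q : Matrix (Fin 2) (Fin 2) ℝ} (hQs : Q.IsSymm) (hQp : Q.PosDef) :
    0 < Q 0 0 ∧ 0 < Q 0 0 * Q 1 1 - Q 0 1 ^ 2 := by
  refine ⟨hQp.diag_pos, ?_⟩
  have h := hQp.det_pos
  rw [Matrix.det_fin_two, hQs.apply 0 1] at h
  linarith

lemma mem_lineThrough_iff {P R p : Pt} :
    p ∈ lineThrough P R ↔ ∃ t : ℝ, AffineMap.lineMap P R t = p :=
  mem_affineSpan_pair_iff_exists_lineMap_eq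

lemma Pt.ext_iff {p q : Pt} : p = q ↔ p 0 = q 0 ∧ p 1 = q 1 := by
  constructor
  · rintro rfl; exact ⟨rfl, rfl⟩
  · rintro ⟨h0, h1⟩
    ext i
    fin_cases i
    · exact h0
    · exact h1

lemma lineMap_apply_coord (P R : Pt) (t : ℝ) (i : Fin 2) :
    (AffineMap.lineMap P R t : Pt) i = P i + t * (R i - P i) := by
  simp [AffineMap.lineMap_apply]; ring

lemma isTangentTo_lineThrough_iff {c : Pt} {Q : Matrix (Fin 2) (Fin 2) ℝ} (hQs : Q.IsSymm)
    (hQp : Q.PosDef) {P R : Pt} (hPR : P ≠ R) :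
    IsTangentTo (lineThrough P R) (ellipseQ c Q) ↔ tangencyForm c Q P R = 0 := by
  obtain ⟨h00, hdet⟩ := posDef_fin_two_coeff hQs hQp
  have h10 : Q 1 0 = Q 0 1 := hQs.apply 0 1
  set A := Q 0 0 * (R 0 - P 0) ^ 2 + 2 * Q 0 1 * (R 0 - P 0) * (R 1 - P 1) +
    Q 1 1 * (R 1 - P 1) ^ 2 with hA_def
  set B := Q 0 0 * (P 0 - c 0) * (R 0 - P 0) + Q 0 1 * ((P 0 - c 0) * (R 1 - P 1) +
    (P 1 - c 1) * (R 0 - P 0)) + Q 1 1 * (P 1 - c 1) * (R 1 - P 1) with hB_def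
  set C := Q 0 0 * (P 0 - c 0) ^ 2 + 2 * Q 0 1 * (P 0 - c 0) * (P 1 - c 1) +
    Q 1 1 * (P 1 - c 1) ^ 2 - 1 with hC_def
  have hA : 0 < A := by
    have hsq : Q 0 0 * A = (Q 0 0 * (R 0 - P 0) + Q 0 1 * (R 1 - P 1)) ^ 2 +
        (Q 0 0 * Q 1 1 - Q 0 1 ^ 2) * (R 1 - P 1) ^ 2 := by rw [hA_def]; ring
    refine pos_of_mul_pos_right (a := Q 0 0) ?_ h00.le
    rw [hsq]
    by_cases h1 : R 1 - P 1 = 0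
    · have h0 : R 0 - P 0 ≠ 0 := fun h0 ↦
        hPR (Pt.ext_iff.2 ⟨by linarith, by linarith⟩)
      rw [h1]
      have := mul_ne_zero h00.ne' h0
      simp only [mul_zero, add_zero]
      positivity
    · positivity
  have hmem : ∀ t : ℝ, AffineMap.lineMap P R t ∈ ellipseQ c Q ↔
      A * t ^ 2 + 2 * B * t + C = 0 := by
    intro t
    simp only [ellipseQ, Set.mem_ofPred_eq, Fin.sum_univ_two, lineMap_apply_coord, h10]
    rw [← sub_eq_zero]
    apply Eq.congr_left
    rw [hA_def, hB_def, hC_def]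
    ring
  have htan : IsTangentTo (lineThrough P R) (ellipseQ c Q) ↔
      ∃! t : ℝ, A * t ^ 2 + 2 * B * t + C = 0 := by
    constructor
    · rintro ⟨p, ⟨hpl, hpe⟩, huniq⟩
      obtain ⟨t, rfl⟩ := mem_lineThrough_iff.1 hpl
      refine ⟨t, (hmem t).1 hpe, fun s hs ↦ ?_⟩
      exact AffineMap.lineMap_injective ℝ hPR
        (huniq _ ⟨mem_lineThrough_iff.2 ⟨s, rfl⟩, (hmem s).2 hs⟩)
    · rintro ⟨t, ht, huniq⟩
      refine ⟨_, ⟨mem_lineThrough_iff.2 ⟨t, rfl⟩, (hmem t).2 ht⟩, ?_⟩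
      rintro p ⟨hpl, hpe⟩
      obtain ⟨s, rfl⟩ := mem_lineThrough_iff.1 hpl
      rw [huniq s ((hmem s).1 hpe)]
  rw [htan, existsUnique_quadratic_root_iff hA]
  apply Eq.congr_left
  rw [tangencyForm, hA_def, hB_def, hC_def]
  ring

/-- At most two lines through a given point are tangent to an ellipse. -/
lemma signedArea_eq_zero_of_tangencyForm {c : Pt} {Q : Matrix (Fin 2) (Fin 2) ℝ}
    (hQs : Q.IsSymm) (hQp : Q.PosDef) {M X Y Z : Pt} (hX : tangencyForm c Q M X = 0)
    (hY : tangencyForm c Q M Y = 0) (hZ : tangencyForm c Q M Z = 0) :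
    signedArea M X Y = 0 ∨ signedArea M X Z = 0 ∨ signedArea M Y Z = 0 := by
  obtain ⟨-, hdet⟩ := posDef_fin_two_coeff hQs hQp
  by_contra! hne
  have hprod := mul_ne_zero (mul_ne_zero hne.1 hne.2.1) hne.2.2
  unfold tangencyForm at hX hY hZ
  unfold signedArea at hprod
  generalize X 0 - M 0 = x₀, X 1 - M 1 = x₁, Y 0 - M 0 = y₀, Y 1 - M 1 = y₁,
    Z 0 - M 0 = z₀, Z 1 - M 1 = z₁, M 0 - c 0 = u₀, M 1 - c 1 = u₁ at *
  set D := Q 0 0 * Q 1 1 - Q 0 1 ^ 2 with hD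
  have h0 : Q 0 0 - D * u₁ ^ 2 = 0 := by
    refine (mul_eq_zero.1 ?_).resolve_right hprod
    linear_combination y₁ * z₁ * (y₀ * z₁ - y₁ * z₀) * hX -
      x₁ * z₁ * (x₀ * z₁ - x₁ * z₀) * hY + x₁ * y₁ * (x₀ * y₁ - x₁ * y₀) * hZ
  have h1 : Q 0 1 + D * u₀ * u₁ = 0 := by
    refine (mul_eq_zero.1 ?_).resolve_right hprod
    linear_combination (-(1 / 2) * (y₀ ^ 2 * z₁ ^ 2 - y₁ ^ 2 * z₀ ^ 2)) * hX +
      (1 / 2) * (x₀ ^ 2 * z₁ ^ 2 - x₁ ^ 2 * z₀ ^ 2) * hY -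
      (1 / 2) * (x₀ ^ 2 * y₁ ^ 2 - x₁ ^ 2 * y₀ ^ 2) * hZ
  have h2 : Q 1 1 - D * u₀ ^ 2 = 0 := by
    refine (mul_eq_zero.1 ?_).resolve_right hprod
    linear_combination y₀ * z₀ * (y₀ * z₁ - y₁ * z₀) * hX -
      x₀ * z₀ * (x₀ * z₁ - x₁ * z₀) * hY + x₀ * y₀ * (x₀ * y₁ - x₁ * y₀) * hZ
  have : D = 0 := by
    rw [hD]
    linear_combination Q 1 1 * h0 + D * u₁ ^ 2 * h2 - (Q 0 1 - D * u₀ * u₁) * h1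
  exact hdet.ne' this

lemma mem_ellipseE_iff {a b : ℝ} {p : Pt} :
    p ∈ ellipseE a b ↔ (a ^ 2)⁻¹ * p 0 ^ 2 + (b ^ 2)⁻¹ * p 1 ^ 2 = 1 := by
  simp only [ellipseE, Set.mem_ofPred_eq, div_eq_inv_mul]

/-- A line through a point of an ellipse meets it in at most one further point. -/
lemma eq_of_mem_ellipseE_of_signedArea {a b : ℝ} (ha : 0 < a) (hb : 0 < b) {M P R : Pt}
    (hM : M ∈ ellipseE a b) (hP : P ∈ ellipseE a b) (hR : R ∈ ellipseE a b)
    (hPM : P ≠ M) (hRM : R ≠ M) (h : signedArea M P R = 0) : P = R := by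
  rw [mem_ellipseE_iff] at hM hP hR
  have hα : 0 < (a ^ 2)⁻¹ := by positivity
  have hβ : 0 < (b ^ 2)⁻¹ := by positivity
  generalize (a ^ 2)⁻¹ = α, (b ^ 2)⁻¹ = β at *
  unfold signedArea at h
  obtain ⟨k, hk0, hk1⟩ : ∃ k : ℝ, R 0 - M 0 = k * (P 0 - M 0) ∧ R 1 - M 1 = k * (P 1 - M 1) := by
    by_cases h0 : P 0 - M 0 = 0
    · have h1 : P 1 - M 1 ≠ 0 := fun h1 ↦ hPM (Pt.ext_iff.2 ⟨by linarith, by linarith⟩)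
      refine ⟨(R 1 - M 1) / (P 1 - M 1), ?_, by field_simp⟩
      field_simp
      linarith
    · refine ⟨(R 0 - M 0) / (P 0 - M 0), by field_simp, ?_⟩
      field_simp
      linarith
  have hR0 : R 0 = M 0 + k * (P 0 - M 0) := by linarith
  have hR1 : R 1 = M 1 + k * (P 1 - M 1) := by linarith
  have hq : α * (P 0 - M 0) ^ 2 + β * (P 1 - M 1) ^ 2 ≠ 0 := by
    intro hq
    have h0 : P 0 - M 0 = 0 := by
      have := (add_eq_zero_iff_of_nonneg (by positivity) (by positivity)).1 hq
      simpa [hα.ne'] using this.1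
    have h1 : P 1 - M 1 = 0 := by
      have := (add_eq_zero_iff_of_nonneg (by positivity) (by positivity)).1 hq
      simpa [hβ.ne'] using this.2
    exact hPM (Pt.ext_iff.2 ⟨by linarith, by linarith⟩)
  have hk : k ≠ 0 := by
    rintro rfl
    exact hRM (Pt.ext_iff.2 ⟨by linarith, by linarith⟩)
  rw [hR0, hR1] at hR
  have hk1 : k - 1 = 0 := by
    refine (mul_eq_zero.1 ?_).resolve_right (mul_ne_zero hk hq)
    linear_combination hR - (1 - k) * hM - k * hP
  obtain rfl : k = 1 := by linarith
  exact Pt.ext_iff.2 ⟨by linarith, by linarith⟩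

/-- The direction at angle `φ` from the tangent at `M` to the ellipse `α x² + β y² = 1`. -/
def tangentRotation (α β : ℝ) (M : Pt) (φ : ℝ) : Pt :=
  !₂[-(Real.cos φ * (β * M 1)) - Real.sin φ * (α * M 0),
    Real.cos φ * (α * M 0) - Real.sin φ * (β * M 1)]

/-- The parameter at which the ray from `M` along `tangentRotation α β M φ` meets the
ellipse again. -/
def chordParam (α β : ℝ) (M : Pt) (φ : ℝ) : ℝ :=
  2 * Real.sin φ * ((α * M 0) ^ 2 + (β * M 1) ^ 2) /
    (α * tangentRotation α β M φ 0 ^ 2 + β * tangentRotation α β M φ 1 ^ 2)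

/-- The second end of the chord from `M` along `tangentRotation α β M φ`. -/
def chordEnd (α β : ℝ) (M : Pt) (φ : ℝ) : Pt :=
  M + chordParam α β M φ • tangentRotation α β M φ

section Chords

variable {α β : ℝ} {M : Pt}

lemma tangentRotation_zero (φ : ℝ) : tangentRotation α β M φ 0 =
    -(Real.cos φ * (β * M 1)) - Real.sin φ * (α * M 0) := rfl

lemma tangentRotation_one (φ : ℝ) : tangentRotation α β M φ 1 =
    Real.cos φ * (α * M 0) - Real.sin φ * (β * M 1) := rfl

lemma chordEnd_coord (φ : ℝ) (i : Fin 2) : chordEnd α β M φ i =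
    M i + chordParam α β M φ * tangentRotation α β M φ i := rfl

lemma gradient_sq_pos (hα : 0 < α) (hβ : 0 < β) (hM : α * M 0 ^ 2 + β * M 1 ^ 2 = 1) :
    0 < (α * M 0) ^ 2 + (β * M 1) ^ 2 := by
  by_contra! h
  have h0 : M 0 = 0 := by
    have : α * M 0 = 0 := by nlinarith [sq_nonneg (α * M 0), sq_nonneg (β * M 1)]
    simpa [hα.ne'] using this
  have h1 : M 1 = 0 := by
    have : β * M 1 = 0 := by nlinarith [sq_nonneg (α * M 0), sq_nonneg (β * M 1)]
    simpa [hβ.ne'] using this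
  simp [h0, h1] at hM

lemma tangentRotation_sq (φ : ℝ) :
    tangentRotation α β M φ 0 ^ 2 + tangentRotation α β M φ 1 ^ 2 =
      (α * M 0) ^ 2 + (β * M 1) ^ 2 := by
  rw [tangentRotation_zero, tangentRotation_one]
  linear_combination ((α * M 0) ^ 2 + (β * M 1) ^ 2) * Real.sin_sq_add_cos_sq φ

lemma chordParam_denom_pos (hα : 0 < α) (hβ : 0 < β) (hM : α * M 0 ^ 2 + β * M 1 ^ 2 = 1)
    (φ : ℝ) :
    0 < α * tangentRotation α β M φ 0 ^ 2 + β * tangentRotation α β M φ 1 ^ 2 := by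
  have h := gradient_sq_pos hα hβ hM
  rw [← tangentRotation_sq φ] at h
  by_cases h0 : tangentRotation α β M φ 0 = 0
  · have h1 : tangentRotation α β M φ 1 ≠ 0 := by
      intro h1
      simp [h0, h1] at h
    positivity
  · positivity

lemma chordParam_pos (hα : 0 < α) (hβ : 0 < β) (hM : α * M 0 ^ 2 + β * M 1 ^ 2 = 1) {φ : ℝ}
    (hφ : φ ∈ Set.Ioo 0 Real.pi) : 0 < chordParam α β M φ := by
  have h1 := gradient_sq_pos hα hβ hM
  have h2 := chordParam_denom_pos hα hβ hM φ
  have h3 := Real.sin_pos_of_mem_Ioo hφ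
  unfold chordParam
  positivity

lemma chordEnd_mem (hα : 0 < α) (hβ : 0 < β) (hM : α * M 0 ^ 2 + β * M 1 ^ 2 = 1) (φ : ℝ) :
    α * chordEnd α β M φ 0 ^ 2 + β * chordEnd α β M φ 1 ^ 2 = 1 := by
  have h := (chordParam_denom_pos hα hβ hM φ).ne'
  have hs : chordParam α β M φ *
      (α * tangentRotation α β M φ 0 ^ 2 + β * tangentRotation α β M φ 1 ^ 2) =
      2 * Real.sin φ * ((α * M 0) ^ 2 + (β * M 1) ^ 2) := div_mul_cancel₀ _ h
  have hm : α * M 0 * tangentRotation α β M φ 0 + β * M 1 * tangentRotation α β M φ 1 =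
      -(Real.sin φ * ((α * M 0) ^ 2 + (β * M 1) ^ 2)) := by
    rw [tangentRotation_zero, tangentRotation_one]; ring
  rw [chordEnd_coord, chordEnd_coord]
  linear_combination hM + chordParam α β M φ * hs + 2 * chordParam α β M φ * hm

lemma continuous_tangentRotation_coord (i : Fin 2) :
    Continuous fun φ ↦ tangentRotation α β M φ i := by
  fin_cases i
  · simp only [Fin.zero_eta, tangentRotation_zero]; fun_prop
  · simp only [Fin.mk_one, tangentRotation_one]; fun_prop

lemma continuous_chordEnd_coord (hα : 0 < α) (hβ : 0 < β)
    (hM : α * M 0 ^ 2 + β * M 1 ^ 2 = 1) (i : Fin 2) :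
    Continuous fun φ ↦ chordEnd α β M φ i := by
  have h0 := continuous_tangentRotation_coord (α := α) (β := β) (M := M) 0
  have h1 := continuous_tangentRotation_coord (α := α) (β := β) (M := M) 1
  have hi := continuous_tangentRotation_coord (α := α) (β := β) (M := M) i
  simp only [chordEnd_coord, chordParam]
  refine continuous_const.add (Continuous.mul (Continuous.div (by fun_prop) (by fun_prop) ?_) hi)
  exact fun φ ↦ (chordParam_denom_pos hα hβ hM φ).ne'

lemma chordEnd_ne (hα : 0 < α) (hβ : 0 < β) (hM : α * M 0 ^ 2 + β * M 1 ^ 2 = 1) {φ : ℝ}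
    (hφ : φ ∈ Set.Ioo 0 Real.pi) : chordEnd α β M φ ≠ M := by
  intro h
  have h0 : chordParam α β M φ * tangentRotation α β M φ 0 = 0 := by
    have := (Pt.ext_iff.1 h).1
    rw [chordEnd_coord] at this
    linarith
  have h1 : chordParam α β M φ * tangentRotation α β M φ 1 = 0 := by
    have := (Pt.ext_iff.1 h).2
    rw [chordEnd_coord] at this
    linarith
  have hs := (chordParam_pos hα hβ hM hφ).ne'
  have hd := chordParam_denom_pos hα hβ hM φ
  rw [(mul_eq_zero.1 h0).resolve_left hs, (mul_eq_zero.1 h1).resolve_left hs] at hd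
  simp at hd

lemma angle_chordEnd (hα : 0 < α) (hβ : 0 < β) (hM : α * M 0 ^ 2 + β * M 1 ^ 2 = 1) {φ δ : ℝ}
    (hφ : φ ∈ Set.Ioo 0 Real.pi) (hφδ : φ + δ ∈ Set.Ioo 0 Real.pi) (hδ : δ ∈ Set.Icc 0 Real.pi) :
    EuclideanGeometry.angle (chordEnd α β M φ) M (chordEnd α β M (φ + δ)) = δ := by
  have hn := gradient_sq_pos hα hβ hM
  have hnorm : ∀ ψ, ‖tangentRotation α β M ψ‖ = √((α * M 0) ^ 2 + (β * M 1) ^ 2) := fun ψ ↦ by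
    rw [EuclideanSpace.norm_eq, Fin.sum_univ_two, Real.norm_eq_abs, Real.norm_eq_abs, sq_abs,
      sq_abs, tangentRotation_sq]
  have hinner : inner ℝ (tangentRotation α β M φ) (tangentRotation α β M (φ + δ)) =
      Real.cos δ * ((α * M 0) ^ 2 + (β * M 1) ^ 2) := by
    rw [PiLp.inner_apply, Fin.sum_univ_two]
    simp only [tangentRotation_zero, tangentRotation_one, RCLike.inner_apply, conj_trivial,
      Real.cos_add, Real.sin_add]
    linear_combination Real.cos δ * ((α * M 0) ^ 2 + (β * M 1) ^ 2) * Real.sin_sq_add_cos_sq φ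
  unfold EuclideanGeometry.angle chordEnd
  rw [vsub_eq_sub, vsub_eq_sub, add_sub_cancel_left, add_sub_cancel_left,
    InnerProductGeometry.angle_smul_left_of_pos _ _ (chordParam_pos hα hβ hM hφ),
    InnerProductGeometry.angle_smul_right_of_pos _ _ (chordParam_pos hα hβ hM hφδ),
    InnerProductGeometry.angle, hnorm, hnorm, hinner, Real.mul_self_sqrt hn.le,
    mul_div_cancel_right₀ _ hn.ne', Real.arccos_cos hδ.1 hδ.2]

lemma chordEnd_of_sin_eq_zero {φ : ℝ} (h : Real.sin φ = 0) : chordEnd α β M φ = M := by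
  simp [chordEnd, chordParam, h]

end Chords

lemma lineThrough_eq_of_isLine {l : Set Pt} (hl : IsLine l) {M T : Pt} (hM : M ∈ l) (hT : T ∈ l)
    (hTM : T ≠ M) : l = lineThrough M T := by
  obtain ⟨P, R, -, rfl⟩ := hl
  have h := affineSpan_pair_eq_of_mem_of_mem_of_ne hM hT hTM.symm
  exact congrArg _ h.symm

/-- **Poncelet triangle for `θ = π/3`.** If `E(c,Q)` is the Frégier ellipse of `M` for
angle `π/3` and `T₁`, `T₂` are the second intersections with `E(a,b)` of the two
tangent lines from `M` to `E(c,Q)`, then the line `T₁T₂` is also tangent to `E(c,Q)`: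
the triangle `M T₁ T₂` circumscribes `E(c,Q)`. -/
theorem fregier_poncelet_triangle (a b : ℝ) (ha : 0 < a) (hb : 0 < b)
    (M : Pt) (hM : M ∈ ellipseE a b)
    (c : Pt) (Q : Matrix (Fin 2) (Fin 2) ℝ) (hQs : Q.IsSymm) (hQp : Q.PosDef)
    (hEnv : ∀ N L : Pt, N ∈ ellipseE a b → L ∈ ellipseE a b →
      M ≠ N → M ≠ L → N ≠ L → EuclideanGeometry.angle N M L = Real.pi / 3 →
      IsTangentTo (lineThrough N L) (ellipseQ c Q))
    (l₁ l₂ : Set Pt) (hl₁ : IsLine l₁) (hl₂ : IsLine l₂) (hll : l₁ ≠ l₂)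
    (hMl₁ : M ∈ l₁) (hMl₂ : M ∈ l₂)
    (htan₁ : IsTangentTo l₁ (ellipseQ c Q)) (htan₂ : IsTangentTo l₂ (ellipseQ c Q))
    (T₁ T₂ : Pt)
    (hT₁ : T₁ ∈ l₁ ∩ ellipseE a b) (hT₂ : T₂ ∈ l₂ ∩ ellipseE a b)
    (hT₁M : T₁ ≠ M) (hT₂M : T₂ ≠ M) :
    IsTangentTo (lineThrough T₁ T₂) (ellipseQ c Q) := by
  have hα : 0 < (a ^ 2)⁻¹ := by positivity
  have hβ : 0 < (b ^ 2)⁻¹ := by positivity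
  have hM' := mem_ellipseE_iff.1 hM
  have hπ := Real.pi_pos
  set N : ℝ → Pt := chordEnd (a ^ 2)⁻¹ (b ^ 2)⁻¹ M with hN
  have hNE : ∀ φ, N φ ∈ ellipseE a b := fun φ ↦ mem_ellipseE_iff.2 (chordEnd_mem hα hβ hM' φ)
  have hNM : ∀ φ ∈ Set.Ioo 0 Real.pi, N φ ≠ M := fun φ ↦ chordEnd_ne hα hβ hM'
  have hne : ∀ φ ∈ Set.Ioo 0 (2 * Real.pi / 3), N φ ≠ N (φ + Real.pi / 3) ∧
      tangencyForm c Q (N φ) (N (φ + Real.pi / 3)) = 0 := by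
    rintro φ ⟨h0, h1⟩
    have hφ : φ ∈ Set.Ioo 0 Real.pi := ⟨h0, by linarith⟩
    have hφ' : φ + Real.pi / 3 ∈ Set.Ioo 0 Real.pi := ⟨by linarith, by linarith⟩
    have hang : EuclideanGeometry.angle (N φ) M (N (φ + Real.pi / 3)) = Real.pi / 3 :=
      angle_chordEnd hα hβ hM' hφ hφ' ⟨by linarith, by linarith⟩
    have hNL : N φ ≠ N (φ + Real.pi / 3) := by
      intro h
      rw [← h, EuclideanGeometry.angle_self_of_ne (hNM φ hφ)] at hang
      linarith
    exact ⟨hNL, (isTangentTo_lineThrough_iff hQs hQp hNL).1 (hEnv _ _ (hNE _) (hNE _)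
      (hNM _ hφ).symm (hNM _ hφ').symm hNL hang)⟩
  have hclosed : IsClosed {φ | tangencyForm c Q (N φ) (N (φ + Real.pi / 3)) = 0} := by
    have hcont := continuous_chordEnd_coord hα hβ hM'
    exact isClosed_eq (continuous_tangencyForm c Q hcont
      fun i ↦ (hcont i).comp (continuous_add_const (Real.pi / 3))) continuous_const
  have hIcc : ∀ φ ∈ Set.Icc 0 (2 * Real.pi / 3),
      tangencyForm c Q (N φ) (N (φ + Real.pi / 3)) = 0 := by
    intro φ hφ
    rw [← closure_Ioo (by positivity)] at hφ
    exact hclosed.closure_subset_iff.2 (fun ψ hψ ↦ (hne ψ hψ).2) hφ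
  obtain ⟨hKL, hKLt⟩ := hne (Real.pi / 3) ⟨by linarith, by linarith⟩
  have hK := hIcc 0 ⟨le_rfl, by linarith⟩
  have hL := hIcc (2 * Real.pi / 3) ⟨by linarith, le_rfl⟩
  have hKM := hNM (Real.pi / 3) ⟨by linarith, by linarith⟩
  have hLM := hNM (Real.pi / 3 + Real.pi / 3) ⟨by linarith, by linarith⟩
  have hKE := hNE (Real.pi / 3)
  have hLE := hNE (Real.pi / 3 + Real.pi / 3)
  rw [zero_add, show N 0 = M from chordEnd_of_sin_eq_zero Real.sin_zero] at hK
  rw [show 2 * Real.pi / 3 + Real.pi / 3 = Real.pi by ring,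
    show N Real.pi = M from chordEnd_of_sin_eq_zero Real.sin_pi, tangencyForm_comm,
    show 2 * Real.pi / 3 = Real.pi / 3 + Real.pi / 3 by ring] at hL
  generalize N (Real.pi / 3 + Real.pi / 3) = L, N (Real.pi / 3) = K at *
  have heq : ∀ {P R : Pt}, P ∈ ellipseE a b → R ∈ ellipseE a b → P ≠ M → R ≠ M →
      signedArea M P R = 0 → P = R := eq_of_mem_ellipseE_of_signedArea ha hb hM
  have hend : ∀ {l : Set Pt} {T : Pt}, IsLine l → M ∈ l → IsTangentTo l (ellipseQ c Q) →
      T ∈ l ∩ ellipseE a b → T ≠ M → T = K ∨ T = L := by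
    intro l T hl hMl htan hT hTM
    rw [lineThrough_eq_of_isLine hl hMl hT.1 hTM,
      isTangentTo_lineThrough_iff hQs hQp hTM.symm] at htan
    rcases signedArea_eq_zero_of_tangencyForm hQs hQp htan hK hL with h | h | h
    · exact Or.inl (heq hT.2 hKE hTM hKM h)
    · exact Or.inr (heq hT.2 hLE hTM hLM h)
    · exact absurd (heq hKE hLE hKM hLM h) hKL
  have hT : T₁ ≠ T₂ := by
    rintro rfl
    exact hll ((lineThrough_eq_of_isLine hl₁ hMl₁ hT₁.1 hT₁M).trans
      (lineThrough_eq_of_isLine hl₂ hMl₂ hT₂.1 hT₂M).symm)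
  rw [isTangentTo_lineThrough_iff hQs hQp hT]
  rcases hend hl₁ hMl₁ htan₁ hT₁ hT₁M with rfl | rfl <;>
    rcases hend hl₂ hMl₂ htan₂ hT₂ hT₂M with rfl | rfl
  · exact absurd rfl hT
  · exact hKLt
  · rwa [tangencyForm_comm]
  · exact absurd rfl hT
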